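/- Let m ≥ 2. For all homogeneous A, B ∈ gl(m|1) one has ρ(A)ρ(B) − (−1)^{|A||B|} ρ(B)ρ(A) = ρ(⟨A,B⟩) as linear operators on V; that is, ρ is a representation of the Lie superalgebra gl(m|1) on V (and by restriction a representation of sl(m|1)). -/

import Mathlib

open ExteriorAlgebra

open Matrix

variable (K : Type) [Field K]

/-- The space of matrices underlying `gl(m|n)`. -/
abbrev gl (m n : ℕ) : Type := Matrix (Fin (m + n)) (Fin (m + n)) K

/-- The parity of an index: indices `< m` are even, the rest odd. -/
def par (m n : ℕ) (i : Fin (m + n)) : ZMod 2 := if (i : ℕ) < m then 0 else 1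

/-- `A` is homogeneous of parity `p`. -/
def IsHom {m n : ℕ} (p : ZMod 2) (A : gl K m n) : Prop :=
  ∀ i j, A i j ≠ 0 → par m n i + par m n j = p

/-- The sign `(-1)^p` for `p : ZMod 2`. -/
def sg (p : ZMod 2) : K := if p = 0 then 1 else -1

/-- The even (block-diagonal) part of a matrix. -/
def evenP {m n : ℕ} (A : gl K m n) : gl K m n :=
  Matrix.of fun i j => if par m n i = par m n j then A i j else 0

/-- The odd (block-off-diagonal) part of a matrix. -/
def oddP {m n : ℕ} (A : gl K m n) : gl K m n :=
  Matrix.of fun i j => if par m n i = par m n j then 0 else A i j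

/-- The super bracket `⟨A,B⟩ = AB - (-1)^{|A||B|} BA` on homogeneous elements,
extended bilinearly to all of `gl(m|n)`. -/
def sbr {m n : ℕ} (A B : gl K m n) : gl K m n :=
  A * B - evenP K B * A - oddP K B * evenP K A + oddP K B * oddP K A

/-- The supertrace `Str(A) = Tr(a) - Tr(d)`. -/
def str {m n : ℕ} (A : gl K m n) : K := ∑ i, sg K (par m n i) * A i i

/-- `sl(m|n)`, the subspace of supertraceless matrices, as a submodule of `gl(m|n)`. -/
def sl (m n : ℕ) : Submodule K (gl K m n) where
  carrier := {A | str K A = 0}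
  add_mem' {A B} hA hB := by
    simp only [Set.mem_setOf_eq, str] at *
    simp [Matrix.add_apply, mul_add, Finset.sum_add_distrib, hA, hB]
  zero_mem' := by simp [str]
  smul_mem' c A hA := by
    simp only [Set.mem_setOf_eq, str] at *
    simp only [Matrix.smul_apply, smul_eq_mul, mul_left_comm, ← Finset.mul_sum, hA, mul_zero]

/-- The exterior algebra `Λ(E)` over `E = 𝕂^m`. -/
abbrev ExtAlg (m : ℕ) : Type := ExteriorAlgebra K (Fin m → K)

/-- The ambient space carrying `V = ⊕_{r=1}^m V_r`: an `m`-tuple of elements of `Λ(E)`,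
the component indexed by `r : Fin m` standing for the piece `V_{r+1} = ⋀^{m-1-r} E`. -/
abbrev Wam (m : ℕ) : Type := Fin m → ExtAlg K m

/-- Left exterior multiplication `ω ↦ v ∧ ω` by a vector `v ∈ E`. -/
def wmul {m : ℕ} (v : Fin m → K) : ExtAlg K m →ₗ[K] ExtAlg K m :=
  LinearMap.mulLeft K (ExteriorAlgebra.ι K v)

/-- Contraction (interior product) `ι_y` by a covector `y ∈ E*`. -/
def ctr {m : ℕ} (y : Module.Dual K (Fin m → K)) : ExtAlg K m →ₗ[K] ExtAlg K m :=
  CliffordAlgebra.contractLeft y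

/-- The derivation action `θ_a` of a matrix `a ∈ M_m(𝕂)` on the exterior algebra,
`θ_a (v₁ ∧ … ∧ v_k) = Σᵢ v₁ ∧ … ∧ (a vᵢ) ∧ … ∧ v_k`; concretely
`θ_a = Σ_{i,j} a_{ij} (e_i ∧ -) ∘ ι_{e_j*}`. -/
def theta {m : ℕ} (a : Matrix (Fin m) (Fin m) K) : ExtAlg K m →ₗ[K] ExtAlg K m :=
  ∑ i, ∑ j, a i j • (wmul K (Pi.single i 1) ∘ₗ ctr K (LinearMap.proj j))

/-- The upper-left `m×m` block `a` of `A ∈ gl(m|1)`. -/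
def blka {m : ℕ} (A : gl K m 1) : Matrix (Fin m) (Fin m) K :=
  Matrix.of fun i j => A (Fin.castSucc i) (Fin.castSucc j)

/-- The upper-right column `x` of `A ∈ gl(m|1)`. -/
def blkx {m : ℕ} (A : gl K m 1) : Fin m → K :=
  fun i => A (Fin.castSucc i) (Fin.last m)

/-- The lower-left row `y` of `A ∈ gl(m|1)`, as a covector. -/
def blky {m : ℕ} (A : gl K m 1) : Module.Dual K (Fin m → K) :=
  ∑ j, A (Fin.last m) (Fin.castSucc j) • (LinearMap.proj j :  (Fin m → K) →ₗ[K] K)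

/-- The lower-right entry `d` of `A ∈ gl(m|1)`. -/
def blkd {m : ℕ} (A : gl K m 1) : K := A (Fin.last m) (Fin.last m)

/-- Component `r` of the action `ρ(A)` on `V = ⊕_{r=1}^m V_r` (slot `r` standing for
`V_{r+1}`, `r = 0, …, m-1`): on `ω ∈ V_r` (paper numbering `r = 1, …, m`) it is
`θ_a ω - (Tr a) ω + r d ω` into `V_r`, plus `(r-1)(x ∧ ω)` into `V_{r-1}`, plus
`ι_y ω` into `V_{r+1}`. -/
def rhoComp {m : ℕ} (A : gl K m 1) (r : Fin m) : Wam K m →ₗ[K] ExtAlg K m :=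
  (theta K (blka K A) - (Matrix.trace (blka K A)) • LinearMap.id
      + ((((r : ℕ) + 1 : ℕ) : K) * blkd K A) • LinearMap.id) ∘ₗ LinearMap.proj r
    + (if h : (r : ℕ) + 1 < m then
        ((((r : ℕ) + 1 : ℕ) : K) • (wmul K (blkx K A) ∘ₗ LinearMap.proj (⟨(r : ℕ) + 1, h⟩ : Fin m)))
      else 0)
    + (if _h : 0 < (r : ℕ) then
        (ctr K (blky K A) ∘ₗ
          LinearMap.proj (⟨(r : ℕ) - 1, lt_of_le_of_lt (Nat.sub_le _ 1) r.isLt⟩ : Fin m))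
      else 0)

/-- The representation `ρ` of `gl(m|1)` on (the ambient space of) `V`. -/
def rho {m : ℕ} (A : gl K m 1) : Wam K m →ₗ[K] Wam K m :=
  LinearMap.pi (rhoComp K A)

/-- The submodule `V = ⊕_{r=1}^m V_r` with `V_r = ⋀^{m-r} E`. -/
def Vsub (m : ℕ) : Submodule K (Wam K m) :=
  Submodule.pi Set.univ fun r => ⋀[K]^(m - 1 - (r : ℕ)) (Fin m → K)

/-- The parity-`p` part of `V`: the sum of those `V_r` with `(m - r) % 2 = p`. -/
def Vpart (m : ℕ) (p : ZMod 2) : Submodule K (Wam K m) :=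
  Submodule.pi Set.univ fun r =>
    if ((m - 1 - (r : ℕ) : ℕ) : ZMod 2) = p then ⋀[K]^(m - 1 - (r : ℕ)) (Fin m → K) else ⊥

/-- The top wedge `e₁ ∧ e₂ ∧ … ∧ e_m ∈ ⋀^m E`. -/
def topWedge (m : ℕ) : ExtAlg K m :=
  (List.ofFn fun i : Fin m => ExteriorAlgebra.ι K (Pi.single i (1 : K))).prod

/-- `η_k = ι_{e_k*}(e₁ ∧ … ∧ e_m) ∈ ⋀^{m-1} E`. -/
def eta {m : ℕ} (k : Fin m) : ExtAlg K m :=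
  ctr K (LinearMap.proj k) (topWedge K m)

section ExteriorOperators

variable {K} {m : ℕ}

lemma wmul_add (v w : Fin m → K) : wmul K (v + w) = wmul K v + wmul K w := by
  refine LinearMap.ext fun ω => ?_
  simp [wmul, add_mul]

lemma wmul_smul (c : K) (v : Fin m → K) : wmul K (c • v) = c • wmul K v := by
  refine LinearMap.ext fun ω => ?_
  simp [wmul]

/-- Exterior multiplication as a linear map in the vector. -/
def wmulHom (K : Type) [Field K] (m : ℕ) :
    (Fin m → K) →ₗ[K] ExtAlg K m →ₗ[K] ExtAlg K m where
  toFun := wmul K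
  map_add' := wmul_add
  map_smul' := wmul_smul

lemma ctr_add (y z : Module.Dual K (Fin m → K)) : ctr K (y + z) = ctr K y + ctr K z := by
  simp [ctr]

lemma ctr_smul (c : K) (y : Module.Dual K (Fin m → K)) : ctr K (c • y) = c • ctr K y := by
  simp [ctr]

/-- Contraction as a linear map in the covector. -/
def ctrHom (K : Type) [Field K] (m : ℕ) :
    Module.Dual K (Fin m → K) →ₗ[K] ExtAlg K m →ₗ[K] ExtAlg K m where
  toFun := ctr K
  map_add' := ctr_add
  map_smul' := ctr_smul

lemma wmul_zero : wmul K (0 : Fin m → K) = 0 := (wmulHom K m).map_zero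

lemma wmul_sub (v w : Fin m → K) : wmul K (v - w) = wmul K v - wmul K w :=
  (wmulHom K m).map_sub v w

lemma wmul_sum {ι : Type*} (s : Finset ι) (f : ι → Fin m → K) :
    wmul K (∑ i ∈ s, f i) = ∑ i ∈ s, wmul K (f i) :=
  map_sum (wmulHom K m) f s

lemma ctr_zero : ctr K (0 : Module.Dual K (Fin m → K)) = 0 := (ctrHom K m).map_zero

lemma ctr_sub (y z : Module.Dual K (Fin m → K)) : ctr K (y - z) = ctr K y - ctr K z :=
  (ctrHom K m).map_sub y z

lemma ctr_sum {ι : Type*} (s : Finset ι) (f : ι → Module.Dual K (Fin m → K)) :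
    ctr K (∑ i ∈ s, f i) = ∑ i ∈ s, ctr K (f i) :=
  map_sum (ctrHom K m) f s

lemma theta_zero : theta K (0 : Matrix (Fin m) (Fin m) K) = 0 := by
  simp [theta]

lemma theta_add (a b : Matrix (Fin m) (Fin m) K) :
    theta K (a + b) = theta K a + theta K b := by
  simp [theta, add_smul, Finset.sum_add_distrib]

lemma theta_smul (c : K) (a : Matrix (Fin m) (Fin m) K) :
    theta K (c • a) = c • theta K a := by
  simp [theta, Finset.smul_sum, mul_smul]

lemma theta_sub (a b : Matrix (Fin m) (Fin m) K) :
    theta K (a - b) = theta K a - theta K b := by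
  rw [sub_eq_add_neg, ← neg_one_smul K b, theta_add, theta_smul]
  module

lemma wmul_map_sub (v : Fin m → K) (ω η : ExtAlg K m) :
    wmul K v (ω - η) = wmul K v ω - wmul K v η :=
  map_sub _ _ _

lemma ctr_wmul (y : Module.Dual K (Fin m → K)) (v : Fin m → K) (ω : ExtAlg K m) :
    ctr K y (wmul K v ω) = y v • ω - wmul K v (ctr K y ω) :=
  CliffordAlgebra.contractLeft_ι_mul (d := y) v ω

lemma ctr_ctr (y z : Module.Dual K (Fin m → K)) (ω : ExtAlg K m) :
    ctr K y (ctr K z ω) = -ctr K z (ctr K y ω) :=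
  CliffordAlgebra.contractLeft_comm _ _ _

lemma wmul_wmul (v w : Fin m → K) (ω : ExtAlg K m) :
    wmul K v (wmul K w ω) = -wmul K w (wmul K v ω) := by
  rw [eq_neg_iff_add_eq_zero]
  simp only [wmul, LinearMap.mulLeft_apply, ← mul_assoc, ← add_mul]
  rw [ι_add_mul_swap, zero_mul]

lemma theta_eq_sum_col (a : Matrix (Fin m) (Fin m) K) (ω : ExtAlg K m) :
    theta K a ω = ∑ j, wmul K (a.col j) (ctr K (LinearMap.proj j) ω) := by
  have h (j : Fin m) : a.col j = ∑ i, a i j • Pi.single i (1 : K) := by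
    ext i; simp [Finset.sum_apply, Pi.single_apply]
  simp only [h, wmul_sum, wmul_smul, theta, LinearMap.sum_apply, LinearMap.smul_apply,
    LinearMap.comp_apply]
  exact Finset.sum_comm

lemma dual_eq_sum_proj (y : Module.Dual K (Fin m → K)) :
    y = ∑ j, y (Pi.single j 1) • (LinearMap.proj j : (Fin m → K) →ₗ[K] K) := by
  ext i
  simp [Pi.single_apply]

lemma ctr_eq_sum (y : Module.Dual K (Fin m → K)) (ω : ExtAlg K m) :
    ctr K y ω = ∑ j, y (Pi.single j 1) • ctr K (LinearMap.proj j) ω := by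
  conv_lhs => rw [dual_eq_sum_proj y]
  simp [ctr_sum, ctr_smul]

lemma theta_vecMulVec (x : Fin m → K) (y : Module.Dual K (Fin m → K)) (ω : ExtAlg K m) :
    theta K (vecMulVec x fun j => y (Pi.single j 1)) ω = wmul K x (ctr K y ω) := by
  have h (j : Fin m) : (vecMulVec x fun j => y (Pi.single j 1)).col j
      = y (Pi.single j 1) • x := by
    ext i; simp [vecMulVec_apply, mul_comm]
  simp [theta_eq_sum_col, ctr_eq_sum y, h, wmul_smul]

lemma theta_wmul (a : Matrix (Fin m) (Fin m) K) (v : Fin m → K) (ω : ExtAlg K m) :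
    theta K a (wmul K v ω) = wmul K (a *ᵥ v) ω + wmul K v (theta K a ω) := by
  have h : a *ᵥ v = ∑ j, v j • a.col j := by
    ext i; simp [mulVec, dotProduct, mul_comm]
  simp only [theta_eq_sum_col, ctr_wmul, wmul_map_sub, map_smul, map_sum, h, wmul_sum, wmul_smul,
    LinearMap.sum_apply, LinearMap.smul_apply, wmul_wmul v, LinearMap.proj_apply,
    ← Finset.sum_add_distrib]
  exact Finset.sum_congr rfl fun _ _ => sub_eq_add_neg _ _

lemma theta_ctr (a : Matrix (Fin m) (Fin m) K) (y : Module.Dual K (Fin m → K))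
    (ω : ExtAlg K m) :
    theta K a (ctr K y ω) = ctr K y (theta K a ω) - ctr K (y ∘ₗ a.mulVecLin) ω := by
  simp only [theta_eq_sum_col, map_sum, ctr_wmul, Finset.sum_sub_distrib, ctr_eq_sum (y ∘ₗ _) ω,
    LinearMap.comp_apply, mulVecLin_apply, mulVec_single_one, ctr_ctr _ y, map_neg,
    Finset.sum_neg_distrib]
  abel

lemma theta_theta (a b : Matrix (Fin m) (Fin m) K) (ω : ExtAlg K m) :
    theta K a (theta K b ω) =
      theta K b (theta K a ω) + theta K (a * b) ω - theta K (b * a) ω := by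
  have hcol (j : Fin m) : a *ᵥ b.col j = (a * b).col j := by
    ext i; simp [mulVec, dotProduct, mul_apply]
  have hrow : ∑ j, wmul K (b.col j) (ctr K (LinearMap.proj j ∘ₗ a.mulVecLin) ω)
      = theta K (b * a) ω := by
    have h (k : Fin m) : (b * a).col k = ∑ j, a j k • b.col j := by
      ext i; simp [mul_apply, mul_comm]
    simp only [ctr_eq_sum (_ ∘ₗ _) ω, theta_eq_sum_col, h, wmul_sum, wmul_smul, map_sum, map_smul,
      LinearMap.sum_apply, LinearMap.smul_apply, LinearMap.comp_apply, mulVecLin_apply,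
      mulVec_single_one, LinearMap.proj_apply, col_apply]
    exact Finset.sum_comm
  rw [theta_eq_sum_col b ω, map_sum]
  simp only [theta_wmul, theta_ctr, map_sub, Finset.sum_add_distrib, Finset.sum_sub_distrib, hrow,
    hcol]
  rw [theta_eq_sum_col b (theta K a ω), theta_eq_sum_col (a * b)]
  abel

end ExteriorOperators

section Blocks

variable {K} {m : ℕ}

lemma blky_single (A : gl K m 1) (j : Fin m) :
    blky K A (Pi.single j 1) = A (Fin.last m) (Fin.castSucc j) := by
  simp [blky, Pi.single_apply]

lemma blka_mul (A B : gl K m 1) :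
    blka K (A * B) = blka K A * blka K B
      + vecMulVec (blkx K A) fun j => blky K B (Pi.single j 1) := by
  ext i j
  simp only [blky_single]
  simp [blka, blkx, mul_apply, vecMulVec_apply, Fin.sum_univ_castSucc]

lemma blkx_mul (A B : gl K m 1) :
    blkx K (A * B) = blka K A *ᵥ blkx K B + blkd K B • blkx K A := by
  ext i
  simp [blka, blkx, blkd, mul_apply, mulVec, dotProduct, Fin.sum_univ_castSucc, mul_comm]

lemma blky_mul (A B : gl K m 1) :
    blky K (A * B) = blky K A ∘ₗ (blka K B).mulVecLin + blkd K A • blky K B := by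
  ext j
  simp only [LinearMap.comp_apply, LinearMap.single_apply, LinearMap.add_apply,
    LinearMap.smul_apply, blky_single, mulVecLin_apply, mulVec_single_one]
  simp [blkd, blky, blka, mul_apply, Fin.sum_univ_castSucc]

lemma blkd_mul (A B : gl K m 1) :
    blkd K (A * B) = blky K A (blkx K B) + blkd K A * blkd K B := by
  simp [blkd, blky, blkx, mul_apply, Fin.sum_univ_castSucc]

lemma vecMulVec_zero_fun (x : Fin m → K) : vecMulVec x (fun _ : Fin m => (0 : K)) = 0 :=
  vecMulVec_zero x

lemma blka_sub_smul (A B : gl K m 1) (c : K) :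
    blka K (A - c • B) = blka K A - c • blka K B := by
  ext i j; simp [blka]

lemma blkx_sub_smul (A B : gl K m 1) (c : K) :
    blkx K (A - c • B) = blkx K A - c • blkx K B := by
  ext i; simp [blkx]

lemma blky_sub_smul (A B : gl K m 1) (c : K) :
    blky K (A - c • B) = blky K A - c • blky K B := by
  ext j; simp [blky_single]

lemma blkd_sub_smul (A B : gl K m 1) (c : K) :
    blkd K (A - c • B) = blkd K A - c * blkd K B := by
  simp [blkd]

lemma dotProduct_dual (x : Fin m → K) (y : Module.Dual K (Fin m → K)) :
    x ⬝ᵥ (fun j => y (Pi.single j 1)) = y x := by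
  conv_rhs => rw [dual_eq_sum_proj y]
  simp [dotProduct, mul_comm]

lemma par_castSucc (i : Fin m) : par m 1 i.castSucc = 0 := by
  simp [par]

lemma par_last : par m 1 (Fin.last m) = 1 := by
  simp [par]

lemma IsHom.blkx_blky_eq_zero {A : gl K m 1} (hA : IsHom K 0 A) :
    blkx K A = 0 ∧ blky K A = 0 := by
  constructor
  · ext i
    by_contra h
    simpa [par_castSucc, par_last] using hA _ _ h
  · ext j
    simp only [LinearMap.comp_apply, LinearMap.single_apply, LinearMap.zero_apply, blky_single]
    by_contra h
    simpa [par_castSucc, par_last] using hA _ _ h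

lemma IsHom.blka_blkd_eq_zero {A : gl K m 1} (hA : IsHom K 1 A) :
    blka K A = 0 ∧ blkd K A = 0 := by
  constructor
  · ext i j
    by_contra h
    simpa [par_castSucc] using hA _ _ h
  · by_contra h
    have := hA _ _ h
    rw [par_last] at this
    revert this
    decide

lemma IsHom.evenP_oddP_of_even {n : ℕ} {A : gl K m n} (hA : IsHom K 0 A) :
    evenP K A = A ∧ oddP K A = 0 := by
  have key (i j) (h : par m n i ≠ par m n j) : A i j = 0 := by
    by_contra h0
    have := hA _ _ h0
    revert h this
    generalize par m n i = p
    generalize par m n j = q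
    revert p q
    decide
  constructor <;> ext i j <;> by_cases h : par m n i = par m n j <;> simp [evenP, oddP, h, key]

lemma IsHom.evenP_oddP_of_odd {n : ℕ} {A : gl K m n} (hA : IsHom K 1 A) :
    evenP K A = 0 ∧ oddP K A = A := by
  have key (i j) (h : par m n i = par m n j) : A i j = 0 := by
    by_contra h0
    have := hA _ _ h0
    revert h this
    generalize par m n i = p
    generalize par m n j = q
    revert p q
    decide
  constructor <;> ext i j <;> by_cases h : par m n i = par m n j <;> simp [evenP, oddP, h, key]

lemma sbr_of_isHom {n : ℕ} {pA pB : ZMod 2} {A B : gl K m n}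
    (hA : IsHom K pA A) (hB : IsHom K pB B) :
    sbr K A B = A * B - sg K (pA * pB) • (B * A) := by
  have h (p : ZMod 2) : p = 0 ∨ p = 1 := by revert p; decide
  obtain rfl | rfl := h pA <;> obtain rfl | rfl := h pB
  · simp [sbr, sg, hB.evenP_oddP_of_even]
  · simp [sbr, sg, hA.evenP_oddP_of_even, hB.evenP_oddP_of_odd]
  · simp [sbr, sg, hB.evenP_oddP_of_even]
  · simp [sbr, sg, hA.evenP_oddP_of_odd, hB.evenP_oddP_of_odd]

end Blocks

section Sequences

variable {K} {m : ℕ}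

/-- The formula defining `rho`, acting on sequences indexed by all of `ℕ`. -/
def seqRho (A : gl K m 1) (u : ℕ → ExtAlg K m) (n : ℕ) : ExtAlg K m :=
  theta K (blka K A) (u n) - trace (blka K A) • u n + (((n : K) + 1) * blkd K A) • u n
    + ((n : K) + 1) • wmul K (blkx K A) (u (n + 1))
    + if n = 0 then 0 else ctr K (blky K A) (u (n - 1))

/-- Extension of a tuple by zero to a sequence. -/
def extendZero (v : Wam K m) (n : ℕ) : ExtAlg K m := if h : n < m then v ⟨n, h⟩ else 0

lemma rho_apply (A : gl K m 1) (v : Wam K m) (r : Fin m) :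
    rho K A v r = seqRho A (extendZero v) r := by
  obtain ⟨n, hn⟩ := r
  cases n with
  | zero => by_cases h : 1 < m <;> simp [rho, rhoComp, seqRho, extendZero, hn, h]
  | succ n =>
    have hn' : n < m := by omega
    by_cases h : n + 1 + 1 < m <;> simp [rho, rhoComp, seqRho, extendZero, hn, hn', h]

lemma ctr_eq_zero_of_mem_exteriorPower_zero (y : Module.Dual K (Fin m → K)) {ω : ExtAlg K m}
    (h : ω ∈ ⋀[K]^0 (Fin m → K)) : ctr K y ω = 0 := by
  rw [exteriorPower, pow_zero, Submodule.mem_one] at h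
  obtain ⟨c, rfl⟩ := h
  exact CliffordAlgebra.contractLeft_algebraMap _ y c

lemma extendZero_rho (A : gl K m 1) {v : Wam K m} (hv : v ∈ Vsub K m) :
    extendZero (rho K A v) = seqRho A (extendZero v) := by
  ext1 n
  by_cases h : n < m
  · simp [extendZero, h, rho_apply]
  · cases n with
    | zero =>
      have h1 : ¬ 1 < m := by omega
      simp [seqRho, extendZero, h, h1]
    | succ k =>
      have h1 : ¬ k + 1 + 1 < m := by omega
      by_cases hk : k < m
      · have hmem : v ⟨k, hk⟩ ∈ ⋀[K]^0 (Fin m → K) := by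
          have : v ⟨k, hk⟩ ∈ ⋀[K]^(m - 1 - k) (Fin m → K) := hv ⟨k, hk⟩ (Set.mem_univ _)
          rwa [show m - 1 - k = 0 by omega] at this
        simp [seqRho, extendZero, h, h1, hk, ctr_eq_zero_of_mem_exteriorPower_zero _ hmem]
      · simp [seqRho, extendZero, h, h1, hk]

lemma seqRho_superbracket {pA pB : ZMod 2} {A B : gl K m 1}
    (hA : IsHom K pA A) (hB : IsHom K pB B) (u : ℕ → ExtAlg K m) (n : ℕ) :
    seqRho A (seqRho B u) n - sg K (pA * pB) • seqRho B (seqRho A u) n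
      = seqRho (sbr K A B) u n := by
  rw [sbr_of_isHom hA hB]
  simp only [seqRho, blka_sub_smul, blkx_sub_smul, blky_sub_smul, blkd_sub_smul, blka_mul, blkx_mul,
    blky_mul, blkd_mul]
  have h (p : ZMod 2) : p = 0 ∨ p = 1 := by revert p; decide
  obtain rfl | rfl := h pA <;> obtain rfl | rfl := h pB
  · obtain ⟨hx, hy⟩ := hA.blkx_blky_eq_zero
    obtain ⟨hx', hy'⟩ := hB.blkx_blky_eq_zero
    rcases n with _ | n
    · simp [hx, hy, hx', hy', sg, wmul_zero, ctr_zero, theta_sub, theta_theta (blka K A),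
        trace_mul_comm (blka K A)]
      module
    · simp [hx, hy, hx', hy', sg, wmul_zero, ctr_zero, theta_sub, theta_theta (blka K A),
        trace_mul_comm (blka K A)]
      module
  · obtain ⟨hx, hy⟩ := hA.blkx_blky_eq_zero
    obtain ⟨ha', hd'⟩ := hB.blka_blkd_eq_zero
    rcases n with _ | n
    · simp [hx, hy, ha', hd', sg, wmul_zero, ctr_zero, wmul_sub, wmul_smul,
        vecMulVec_zero_fun, theta_zero, theta_wmul]
      module
    · simp [hx, hy, ha', hd', sg, wmul_zero, ctr_zero, wmul_sub, wmul_smul,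
        ctr_sub, ctr_smul, vecMulVec_zero_fun, theta_zero, theta_wmul, theta_ctr]
      module
  · obtain ⟨ha, hd⟩ := hA.blka_blkd_eq_zero
    obtain ⟨hx', hy'⟩ := hB.blkx_blky_eq_zero
    rcases n with _ | n
    · simp [ha, hd, hx', hy', sg, wmul_zero, ctr_zero, wmul_sub, wmul_smul,
        vecMulVec_zero_fun, theta_zero, theta_wmul]
      module
    · simp [ha, hd, hx', hy', sg, wmul_zero, ctr_zero, wmul_sub, wmul_smul,
        ctr_sub, ctr_smul, vecMulVec_zero_fun, theta_zero, theta_wmul, theta_ctr]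
      module
  · obtain ⟨ha, hd⟩ := hA.blka_blkd_eq_zero
    obtain ⟨ha', hd'⟩ := hB.blka_blkd_eq_zero
    rcases n with _ | _ | n
    · simp [ha, hd, ha', hd', sg, wmul_zero, theta_zero, theta_add, theta_vecMulVec,
        dotProduct_dual, wmul_wmul (blkx K A)]
      module
    · simp [ha, hd, ha', hd', sg, wmul_zero, ctr_zero, theta_zero, theta_add, theta_vecMulVec,
        dotProduct_dual, ctr_wmul, wmul_wmul (blkx K A)]
      module
    · simp [ha, hd, ha', hd', sg, wmul_zero, ctr_zero, theta_zero, theta_add, theta_vecMulVec,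
        dotProduct_dual, ctr_wmul, wmul_wmul (blkx K A), ctr_ctr (blky K A)]
      module

end Sequences

/-- Let `m ≥ 2`.  For all homogeneous `A, B ∈ gl(m|1)` one has
`ρ(A)ρ(B) - (-1)^{|A||B|} ρ(B)ρ(A) = ρ(⟨A,B⟩)` as linear operators on `V`; that is,
`ρ` is a representation of the Lie superalgebra `gl(m|1)` on `V` (and by restriction
a representation of `sl(m|1)`). -/
theorem rho_is_representation
    (K : Type) [Field K] [IsAlgClosed K] [CharZero K] (m : ℕ) (hm : 2 ≤ m)
    (pA pB : ZMod 2) (A B : gl K m 1) (hA : IsHom K pA A) (hB : IsHom K pB B) :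
    ∀ v ∈ Vsub K m,
      rho K A (rho K B v) - sg K (pA * pB) • rho K B (rho K A v) = rho K (sbr K A B) v := by
  intro v hv
  ext1 r
  rw [Pi.sub_apply, Pi.smul_apply, rho_apply, rho_apply, rho_apply, extendZero_rho A hv,
    extendZero_rho B hv]
  exact seqRho_superbracket hA hB _ _
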